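/- There exist constants R₀ > 0, c > 0, C > 0 such that for every small-hard-star background (r₀, m₀, ρ₀) in comoving coordinates on [0,B] with surface radius R = r₀(B) < R₀, and for every u ∈ C¹([0,B]) with u(0) = 0 and every continuous v : [0,B] → ℝ, the second-variation quadratic form is equivalent to the natural energy: c·∫₀^B [ u²/r₀² + v² + r₀⁴ (∂_χ u)² ] dχ ≤ Q[u,v] ≤ C·∫₀^B [ u²/r₀² + v² + r₀⁴ (∂_χ u)² ] dχ. -/

import Mathlib

open Real Set Filter

noncomputable section

/-- `f` is C¹ on `s`. -/
def C1On (f : ℝ → ℝ) (s : Set ℝ) : Prop :=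
  (∀ x ∈ s, DifferentiableAt ℝ f x) ∧ ContinuousOn (deriv f) s

/-- A small hard star of radius `R` with smallness constant `C`
(units `G = c = ρ₀ = 1`). -/
def IsSmallStar (C R : ℝ) (m ρ : ℝ → ℝ) : Prop :=
  0 < R ∧ ContinuousOn m (Icc 0 R) ∧ ContinuousOn ρ (Icc 0 R) ∧
  m 0 = 0 ∧ ρ R = 1 ∧
  (∀ r ∈ Ioo (0:ℝ) R,
    HasDerivAt m (4 * π * r ^ 2 * ρ r) r ∧
    HasDerivAt ρ (-((2 * ρ r - 1) / (r - 2 * m r)) *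
      (m r / r + 4 * π * r ^ 2 * (ρ r - 1))) r) ∧
  (∀ r ∈ Ioc (0:ℝ) R,
    1 ≤ ρ r ∧ ρ r ≤ 1 + C * R ^ 2 ∧
    1 ≤ 3 / (4 * π) * (m r / r ^ 3) ∧
    3 / (4 * π) * (m r / r ^ 3) ≤ 1 + C * R ^ 2)

/-- The comoving derivative `dr/dχ = g(r) = √(1 − 2m(r)/r)/(4πr²√(2ρ(r)−1))`. -/
def gfun (m ρ : ℝ → ℝ) (r : ℝ) : ℝ :=
  Real.sqrt (1 - 2 * m r / r) / (4 * π * r ^ 2 * Real.sqrt (2 * ρ r - 1))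

/-- Comoving coordinates: `r₀ : [0,B] → [0,R]` solves `∂_χ r₀ = g(r₀)`,
`r₀(0) = 0`, `r₀(B) = R`. -/
def IsComoving (R B : ℝ) (m ρ r₀ : ℝ → ℝ) : Prop :=
  0 < B ∧ r₀ 0 = 0 ∧ r₀ B = R ∧ ContinuousOn r₀ (Icc 0 B) ∧
  (∀ χ ∈ Icc (0:ℝ) B, r₀ χ ∈ Icc 0 R) ∧
  ∀ χ ∈ Ioc (0:ℝ) B, HasDerivAt r₀ (gfun m ρ (r₀ χ)) χ

/-- Integrand of the second-variation quadratic form `Q[u,v]`. -/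
def Qint (m ρ r₀ : ℝ → ℝ) (u v : ℝ → ℝ) (χ : ℝ) : ℝ :=
  (8 * π * ρ (r₀ χ) * gfun m ρ (r₀ χ) * u χ ^ 2
    + 16 * π * r₀ χ * ρ (r₀ χ) * u χ * deriv u χ
    - 6 * ((4 * π * r₀ χ * (ρ (r₀ χ) - 1) + m (r₀ χ) / r₀ χ ^ 2) /
        (4 * π * r₀ χ ^ 3 * gfun m ρ (r₀ χ))) * u χ ^ 2
    + 2 * ((1 - 2 * m (r₀ χ) / r₀ χ) / (4 * π * r₀ χ ^ 4 * gfun m ρ (r₀ χ))) * u χ ^ 2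
    - 2 * ((4 * π * r₀ χ * (ρ (r₀ χ) - 1) + m (r₀ χ) / r₀ χ ^ 2) /
        (4 * π * r₀ χ ^ 2 * gfun m ρ (r₀ χ) ^ 2)) * u χ * deriv u χ
    + ((1 - 2 * m (r₀ χ) / r₀ χ) / (4 * π * r₀ χ ^ 2 * gfun m ρ (r₀ χ) ^ 3)) *
        deriv u χ ^ 2
    + ((2 * ρ (r₀ χ) - 1) / (4 * π * r₀ χ ^ 2 * gfun m ρ (r₀ χ))) * v χ ^ 2) *
  Real.exp (∫ s in (0:ℝ)..χ, 1 / (4 * π * r₀ s ^ 3 * gfun m ρ (r₀ s)))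

/-- The second-variation quadratic form `Q[u,v]`. -/
def Qform (m ρ r₀ : ℝ → ℝ) (B : ℝ) (u v : ℝ → ℝ) : ℝ :=
  ∫ χ in (0:ℝ)..B, Qint m ρ r₀ u v χ

/-- The natural energy `∫₀^B [u²/r₀² + v² + r₀⁴ (∂_χ u)²] dχ`. -/
def En (r₀ : ℝ → ℝ) (B : ℝ) (u v : ℝ → ℝ) : ℝ :=
  ∫ χ in (0:ℝ)..B, (u χ ^ 2 / r₀ χ ^ 2 + v χ ^ 2 + r₀ χ ^ 4 * deriv u χ ^ 2)

lemma coefficient_bounds {ρ E a w s q p : ℝ} (hρ : 1 ≤ ρ) (hρ' : ρ ≤ 1001 / 1000)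
    (hE : 1 ≤ E) (hE' : E ≤ 101 / 100) (ha : 99 / 100 ≤ a) (ha' : a ≤ 1)
    (hw : 99 / 100 ≤ w) (hw' : w ≤ 1) (hs : 0 ≤ s) (hs' : s ≤ 6) (hq : 0 ≤ q)
    (hq' : q ≤ 1 / 1000) (hp : 1 ≤ p) (hp' : p ≤ 11 / 10) (x y v : ℝ) :
    1 / 4 * (x ^ 2 + y ^ 2 + v ^ 2) ≤
      (2 * ρ * a * x ^ 2 + 4 * ρ * (x * y) - 6 * (s * q / a) * x ^ 2 + 2 * (w / a) * x ^ 2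
        - 2 * (s * q / a ^ 2) * (x * y) + w / a ^ 3 * y ^ 2 + p / a * v ^ 2) * E
        - (2 * a * x ^ 2 + 4 * (x * y)) ∧
    |(2 * ρ * a * x ^ 2 + 4 * ρ * (x * y) - 6 * (s * q / a) * x ^ 2 + 2 * (w / a) * x ^ 2
        - 2 * (s * q / a ^ 2) * (x * y) + w / a ^ 3 * y ^ 2 + p / a * v ^ 2) * E| ≤
      10 * (x ^ 2 + y ^ 2 + v ^ 2) := by
  obtain ⟨i, hi⟩ : ∃ i, i = a⁻¹ := ⟨_, rfl⟩
  have ha0 : 0 < a := by linarith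
  have hia : i * a = 1 := by rw [hi]; exact inv_mul_cancel₀ ha0.ne'
  have hi1 : 1 ≤ i := by rw [hi]; exact (one_le_inv₀ ha0).2 ha'
  have hi2 : i ≤ 102 / 100 := by nlinarith
  have one_le {s t : ℝ} (hs : 1 ≤ s) (ht : 1 ≤ t) : 1 ≤ s * t :=
    one_le_mul_of_one_le_of_one_le hs ht
  have mul_le {s t S T : ℝ} (hs : 0 ≤ s) (hs' : s ≤ S) (ht : 0 ≤ t) (ht' : t ≤ T) :
      s * t ≤ S * T := mul_le_mul hs' ht' ht (hs.trans hs')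
  have hsq : 0 ≤ s * q := mul_nonneg hs hq
  have hsq' : s * q ≤ 6 * (1 / 1000) := mul_le hs hs' hq hq'
  have hρE := one_le hρ hE
  have hρE' : ρ * E ≤ 1001 / 1000 * (101 / 100) :=
    mul_le (by linarith) hρ' (by linarith) hE'
  have hEi := one_le hE hi1
  have hEi' : E * i ≤ 101 / 100 * (102 / 100) :=
    mul_le (by linarith) hE' (by linarith) hi2
  have hEi2 := one_le hEi hi1
  have hEi2' : E * i * i ≤ 101 / 100 * (102 / 100) * (102 / 100) :=
    mul_le (by linarith) hEi' (by linarith) hi2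
  have hEi3 := one_le hEi2 hi1
  have hEi3' : E * i * i * i ≤ 101 / 100 * (102 / 100) * (102 / 100) * (102 / 100) :=
    mul_le (by linarith) hEi2' (by linarith) hi2
  obtain ⟨A, hA⟩ : ∃ A, A = 2 * (a * (ρ * E)) + 2 * (w * (E * i)) - 6 * ((s * q) * (E * i)) :=
    ⟨_, rfl⟩
  obtain ⟨H, hH⟩ : ∃ H, H = 4 * (ρ * E) - 2 * ((s * q) * (E * i * i)) := ⟨_, rfl⟩
  obtain ⟨K, hK⟩ : ∃ K, K = w * (E * i * i * i) := ⟨_, rfl⟩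
  obtain ⟨L, hL⟩ : ∃ L, L = p * (E * i) := ⟨_, rfl⟩
  have h1 := mul_le_mul_of_nonneg_left hρE ha0.le
  have h2 := mul_le ha0.le ha' (by linarith) hρE'
  have h3 := mul_le (by norm_num) hw (by norm_num) hEi
  have h4 := mul_le (by linarith) hw' (by linarith) hEi'
  have h5 := mul_le hsq hsq' (by linarith) hEi'
  have h6 : 0 ≤ (s * q) * (E * i) := mul_nonneg hsq (by linarith)
  have h7 := mul_le hsq hsq' (by linarith) hEi2'
  have h8 : 0 ≤ (s * q) * (E * i * i) := mul_nonneg hsq (by linarith)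
  have h9 := mul_le (by norm_num) hw (by norm_num) hEi3
  have h10 := mul_le (by linarith) hw' (by linarith) hEi3'
  have h11 := one_le hp hEi
  have h12 := mul_le (by linarith) hp' (by linarith) hEi'
  have hA1 : 1 ≤ A - 2 * a := by linarith
  have hA2 : A ≤ 5 := by linarith
  have hH1 : |H - 4| ≤ 1 := by rw [abs_le]; constructor <;> linarith
  have hK1 : 9 / 10 ≤ K := by linarith
  have hK2 : K ≤ 2 := by linarith
  have hL1 : 1 ≤ L := by linarith
  have hL2 : L ≤ 2 := by linarith
  have key : (2 * ρ * a * x ^ 2 + 4 * ρ * (x * y) - 6 * (s * q / a) * x ^ 2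
      + 2 * (w / a) * x ^ 2 - 2 * (s * q / a ^ 2) * (x * y) + w / a ^ 3 * y ^ 2
      + p / a * v ^ 2) * E = A * x ^ 2 + H * (x * y) + K * y ^ 2 + L * v ^ 2 := by
    simp only [div_eq_mul_inv, ← inv_pow, ← hi, hA, hH, hK, hL]; ring
  have hxy : |x * y| ≤ (x ^ 2 + y ^ 2) / 2 := by
    rw [abs_le]
    constructor <;> nlinarith only [sq_nonneg (x + y), sq_nonneg (x - y)]
  have hHxy : |(H - 4) * (x * y)| ≤ (x ^ 2 + y ^ 2) / 2 := by
    rw [abs_mul]; exact (mul_le_of_le_one_left (abs_nonneg _) hH1).trans hxy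
  rw [key, abs_le]
  rw [abs_le] at hxy hHxy
  have hA3 := mul_le_mul_of_nonneg_right hA1 (sq_nonneg x)
  have hA4 := mul_le_mul_of_nonneg_right hA2 (sq_nonneg x)
  have hK3 := mul_le_mul_of_nonneg_right hK1 (sq_nonneg y)
  have hK4 := mul_le_mul_of_nonneg_right hK2 (sq_nonneg y)
  have hL3 := mul_le_mul_of_nonneg_right hL1 (sq_nonneg v)
  have hL4 := mul_le_mul_of_nonneg_right hL2 (sq_nonneg v)
  have hax : 0 ≤ a * x ^ 2 := by positivity
  have hx := sq_nonneg x
  have hy := sq_nonneg y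
  have hv := sq_nonneg v
  refine ⟨?_, ?_, ?_⟩
  · linarith only [hHxy.1, hA3, hK3, hL3, hx, hy, hv]
  · linarith only [hHxy.1, hxy.1, hA3, hK3, hL3, hx, hy, hv, hax]
  · linarith only [hHxy.2, hxy.2, hA4, hK4, hL4, hx, hy, hv]

lemma quadratic_form_bounds {r g m ρ E : ℝ} (hr : 0 < r) (hr' : r ^ 2 ≤ 1 / 10000)
    (hρ : 1 ≤ ρ) (hρ' : ρ ≤ 1 + 1 / 10000) (hm : 0 ≤ m / r ^ 3) (hm' : m / r ^ 3 ≤ 5)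
    (hg : 99 / 100 ≤ 4 * π * r ^ 2 * g) (hg' : 4 * π * r ^ 2 * g ≤ 1)
    (hE : 1 ≤ E) (hE' : E ≤ 101 / 100) (u d v : ℝ) :
    1 / 4 * (u ^ 2 / r ^ 2 + v ^ 2 + r ^ 4 * d ^ 2) + 8 * π * (g * u ^ 2 + 2 * r * u * d) ≤
      (8 * π * ρ * g * u ^ 2 + 16 * π * r * ρ * u * d
        - 6 * ((4 * π * r * (ρ - 1) + m / r ^ 2) / (4 * π * r ^ 3 * g)) * u ^ 2
        + 2 * ((1 - 2 * m / r) / (4 * π * r ^ 4 * g)) * u ^ 2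
        - 2 * ((4 * π * r * (ρ - 1) + m / r ^ 2) / (4 * π * r ^ 2 * g ^ 2)) * u * d
        + ((1 - 2 * m / r) / (4 * π * r ^ 2 * g ^ 3)) * d ^ 2
        + ((2 * ρ - 1) / (4 * π * r ^ 2 * g)) * v ^ 2) * E ∧
    |(8 * π * ρ * g * u ^ 2 + 16 * π * r * ρ * u * d
        - 6 * ((4 * π * r * (ρ - 1) + m / r ^ 2) / (4 * π * r ^ 3 * g)) * u ^ 2
        + 2 * ((1 - 2 * m / r) / (4 * π * r ^ 4 * g)) * u ^ 2
        - 2 * ((4 * π * r * (ρ - 1) + m / r ^ 2) / (4 * π * r ^ 2 * g ^ 2)) * u * d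
        + ((1 - 2 * m / r) / (4 * π * r ^ 2 * g ^ 3)) * d ^ 2
        + ((2 * ρ - 1) / (4 * π * r ^ 2 * g)) * v ^ 2) * E| ≤
      2560 * (u ^ 2 / r ^ 2 + v ^ 2 + r ^ 4 * d ^ 2) ∧
    |g * u ^ 2 + 2 * r * u * d| ≤ 2560 * (u ^ 2 / r ^ 2 + v ^ 2 + r ^ 4 * d ^ 2) := by
  obtain ⟨a, ha⟩ : ∃ a, a = 4 * π * r ^ 2 * g := ⟨_, rfl⟩
  obtain ⟨M, hM⟩ : ∃ M, M = m / r ^ 3 := ⟨_, rfl⟩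
  obtain ⟨x, hx⟩ : ∃ x, x = u / r := ⟨_, rfl⟩
  obtain ⟨y, hy⟩ : ∃ y, y = 4 * π * r ^ 2 * d := ⟨_, rfl⟩
  have hπ := Real.pi_pos
  have hπ4 := Real.pi_lt_four
  have hπ3 := Real.pi_gt_three
  rw [← ha] at hg hg'
  rw [← hM] at hm hm'
  have ha0 : 0 < a := by linarith
  have hgeq : g = a / (4 * π * r ^ 2) := by rw [ha]; field_simp
  have hmeq : m = M * r ^ 3 := by rw [hM]; field_simp
  have hueq : u = x * r := by rw [hx]; field_simp
  have hdeq : d = y / (4 * π * r ^ 2) := by rw [hy]; field_simp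
  have hMr : M * r ^ 2 ≤ 5 / 10000 := by nlinarith [sq_nonneg r]
  have hMr0 : 0 ≤ M * r ^ 2 := by positivity
  have B := coefficient_bounds (ρ := ρ) (E := E) (a := a) (w := 1 - 2 * (M * r ^ 2))
    (s := 4 * π * (ρ - 1) + M) (q := r ^ 2) (p := 2 * ρ - 1) hρ (by linarith) hE hE' hg hg'
    (by linarith) (by linarith) (by nlinarith) (by nlinarith) (by positivity) (by linarith)
    (by linarith) (by linarith) x y v
  have hform : (8 * π * ρ * g * u ^ 2 + 16 * π * r * ρ * u * d
        - 6 * ((4 * π * r * (ρ - 1) + m / r ^ 2) / (4 * π * r ^ 3 * g)) * u ^ 2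
        + 2 * ((1 - 2 * m / r) / (4 * π * r ^ 4 * g)) * u ^ 2
        - 2 * ((4 * π * r * (ρ - 1) + m / r ^ 2) / (4 * π * r ^ 2 * g ^ 2)) * u * d
        + ((1 - 2 * m / r) / (4 * π * r ^ 2 * g ^ 3)) * d ^ 2
        + ((2 * ρ - 1) / (4 * π * r ^ 2 * g)) * v ^ 2) =
      (2 * ρ * a * x ^ 2 + 4 * ρ * (x * y) - 6 * ((4 * π * (ρ - 1) + M) * r ^ 2 / a) * x ^ 2
        + 2 * ((1 - 2 * (M * r ^ 2)) / a) * x ^ 2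
        - 2 * ((4 * π * (ρ - 1) + M) * r ^ 2 / a ^ 2) * (x * y)
        + (1 - 2 * (M * r ^ 2)) / a ^ 3 * y ^ 2 + (2 * ρ - 1) / a * v ^ 2) := by
    subst hgeq hmeq hueq hdeq
    congr 1
    · congr 1
      · congr 1
        · congr 1
          · congr 1
            · congr 1
              · field_simp; ring
              · field_simp; ring
            · field_simp
          · field_simp
        · field_simp
      · field_simp
    · field_simp
  have hD : g * u ^ 2 + 2 * r * u * d = (2 * a * x ^ 2 + 4 * (x * y)) / (8 * π) := by
    rw [hgeq, hueq, hdeq]; field_simp; ring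
  have hx2 : u ^ 2 / r ^ 2 = x ^ 2 := by rw [hx]; ring
  have hy2 : r ^ 4 * d ^ 2 = y ^ 2 / (16 * π ^ 2) := by rw [hy]; field_simp; ring
  have hπsq : π ^ 2 ≤ 16 := by nlinarith only [hπ3, hπ4]
  have hy3 : y ^ 2 / (16 * π ^ 2) ≤ y ^ 2 :=
    div_le_self (sq_nonneg y) (by nlinarith only [hπ3])
  have hy4 : y ^ 2 ≤ 256 * (y ^ 2 / (16 * π ^ 2)) := by
    rw [← mul_div_assoc, le_div_iff₀ (by positivity)]
    nlinarith only [mul_le_mul_of_nonneg_left hπsq (sq_nonneg y)]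
  rw [hform, hD, hx2, hy2, mul_div_cancel₀ _ (by positivity : 8 * π ≠ 0)]
  have h1 := sq_nonneg x
  have h2 := sq_nonneg y
  have h3 := sq_nonneg v
  refine ⟨by linarith only [B.1, hy3, h1, h2, h3], by linarith only [B.2, hy4, h1, h2, h3], ?_⟩
  rw [abs_div, abs_of_pos (by positivity : 0 < 8 * π)]
  refine (div_le_self (abs_nonneg _) (by linarith)).trans ?_
  have hax : a * x ^ 2 ≤ x ^ 2 := mul_le_of_le_one_left h1 hg'
  have hax0 : 0 ≤ a * x ^ 2 := by positivity
  rw [abs_le]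
  constructor <;> nlinarith only [sq_nonneg (x + y), sq_nonneg (x - y), hax, hax0, hy4, h1, h2, h3]

lemma IsSmallStar.bounds {C R : ℝ} {m ρ : ℝ → ℝ} (h : IsSmallStar C R m ρ)
    (hR : R ^ 2 ≤ 1 / 10000) (hC : C * R ^ 2 ≤ 1 / 10000) {r : ℝ} (hr : r ∈ Ioc 0 R) :
    r ^ 2 ≤ 1 / 10000 ∧ 1 ≤ ρ r ∧ ρ r ≤ 1 + 1 / 10000 ∧ 0 ≤ m r / r ^ 3 ∧ m r / r ^ 3 ≤ 5 ∧
      99 / 100 ≤ 4 * π * r ^ 2 * gfun m ρ r ∧ 4 * π * r ^ 2 * gfun m ρ r ≤ 1 := by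
  obtain ⟨-, -, -, -, -, -, hb⟩ := h
  obtain ⟨h1, h2, h3, h4⟩ := hb r hr
  have hr0 := hr.1
  have hπ := Real.pi_pos
  have hπ' := Real.pi_lt_d2
  have hr2 : r ^ 2 ≤ 1 / 10000 := (pow_le_pow_left₀ hr0.le hr.2 2).trans hR
  have hρ : ρ r ≤ 1 + 1 / 10000 := by linarith
  obtain ⟨M, hM⟩ : ∃ M, M = m r / r ^ 3 := ⟨_, rfl⟩
  rw [← hM] at h3 h4 ⊢
  have hM0 : 0 ≤ M := by
    by_contra! hneg
    have : 3 / (4 * π) * M < 0 := mul_neg_of_pos_of_neg (by positivity) hneg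
    linarith
  have hM5 : M ≤ 5 := by
    have : M = 4 * π / 3 * (3 / (4 * π) * M) := by field_simp
    rw [this]
    nlinarith only [hC, h4, hπ, hπ']
  have hmr : 2 * m r / r = 2 * (M * r ^ 2) := by rw [hM]; field_simp
  have hMr : M * r ^ 2 ≤ 5 * (1 / 10000) := mul_le_mul hM5 hr2 (sq_nonneg r) (by norm_num)
  have hMr0 : 0 ≤ M * r ^ 2 := by positivity
  have ha : 4 * π * r ^ 2 * gfun m ρ r =
      √((1 - 2 * (M * r ^ 2)) / (2 * ρ r - 1)) := by
    rw [Real.sqrt_div (by linarith), gfun, hmr]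
    have : 0 < √(2 * ρ r - 1) := Real.sqrt_pos.2 (by linarith)
    field_simp
  rw [ha]
  refine ⟨hr2, h1, hρ, hM0, hM5, ?_, ?_⟩
  · apply Real.le_sqrt_of_sq_le
    rw [le_div_iff₀ (by linarith)]
    linarith
  · rw [Real.sqrt_le_one, div_le_one (by linarith)]
    linarith

lemma IsSmallStar.continuousOn_gfun {C R : ℝ} {m ρ : ℝ → ℝ} (h : IsSmallStar C R m ρ) :
    ContinuousOn (gfun m ρ) (Ioc 0 R) := by
  obtain ⟨-, hm, hρ, -, -, -, hb⟩ := h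
  have hm := hm.mono Ioc_subset_Icc_self
  have hρ := hρ.mono Ioc_subset_Icc_self
  unfold gfun
  refine ContinuousOn.div ?_ ?_ fun r hr ↦ ?_
  · exact (continuousOn_const.sub ((continuousOn_const.mul hm).div continuousOn_id
      fun r hr ↦ hr.1.ne')).sqrt
  · exact (continuousOn_const.mul (continuousOn_id.pow 2)).mul
      ((continuousOn_const.mul hρ).sub continuousOn_const).sqrt
  · have h1 := (hb r hr).1
    have : 0 < √(2 * ρ r - 1) := Real.sqrt_pos.2 (by linarith)
    have := hr.1
    positivity

section Comoving

variable {R B : ℝ} {m ρ r₀ : ℝ → ℝ}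

lemma IsComoving.hasDerivAt_cube (h : IsComoving R B m ρ r₀) {χ : ℝ} (hχ : χ ∈ Ioc 0 B) :
    HasDerivAt (fun s ↦ r₀ s ^ 3) (3 * r₀ χ ^ 2 * gfun m ρ (r₀ χ)) χ := by
  obtain ⟨-, -, -, -, -, hd⟩ := h
  simpa using (hd χ hχ).fun_pow 3

lemma one_fifth_le_cube_deriv
    (hg : ∀ r ∈ Ioc 0 R, 99 / 100 ≤ 4 * π * r ^ 2 * gfun m ρ r) {r : ℝ} (hr : r ∈ Ioc 0 R) :
    1 / 5 ≤ 3 * r ^ 2 * gfun m ρ r := by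
  have hπ := Real.pi_pos
  have hπ' := Real.pi_lt_d2
  have h := hg r hr
  by_contra! hlt
  have := mul_lt_mul_of_pos_left hlt hπ
  linarith

/-- By Darboux's theorem `∂_χ (r₀³)` cannot jump from `0` to at least `1/5`, so `r₀` does not
stick to the centre. -/
lemma IsComoving.pos (h : IsComoving R B m ρ r₀) (hR : 0 < R)
    (hg : ∀ r ∈ Ioc 0 R, 99 / 100 ≤ 4 * π * r ^ 2 * gfun m ρ r) {χ : ℝ} (hχ : χ ∈ Ioc 0 B) :
    0 < r₀ χ := by
  obtain ⟨hB, -, hRB, -, hmem, -⟩ := id h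
  have hsub {s : ℝ} (hs : s ∈ Icc χ B) : s ∈ Ioc 0 B := ⟨hχ.1.trans_le hs.1, hs.2⟩
  by_contra! hle
  have h0 : r₀ χ = 0 := le_antisymm hle (hmem χ (Ioc_subset_Icc_self hχ)).1
  obtain ⟨s, hs, hs'⟩ := exists_hasDerivWithinAt_eq_of_gt_of_lt (m := 1 / 10) hχ.2
    (fun s hs ↦ (h.hasDerivAt_cube (hsub hs)).hasDerivWithinAt) (by simp [h0])
    (by
      have := one_fifth_le_cube_deriv hg (r := r₀ B) (by rw [hRB]; exact ⟨hR, le_rfl⟩)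
      linarith)
  have hsm := hmem s (Ioc_subset_Icc_self (hsub (Ioo_subset_Icc_self hs)))
  dsimp only at hs'
  rcases hsm.1.eq_or_lt with h1 | h1
  · rw [← h1] at hs'; norm_num at hs'
  · have := one_fifth_le_cube_deriv hg ⟨h1, hsm.2⟩
    linarith

lemma IsComoving.mem_Ioc (h : IsComoving R B m ρ r₀) (hR : 0 < R)
    (hg : ∀ r ∈ Ioc 0 R, 99 / 100 ≤ 4 * π * r ^ 2 * gfun m ρ r) {χ : ℝ} (hχ : χ ∈ Ioc 0 B) :
    r₀ χ ∈ Ioc 0 R :=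
  ⟨h.pos hR hg hχ, (h.2.2.2.2.1 χ (Ioc_subset_Icc_self hχ)).2⟩

lemma IsComoving.le_cube (h : IsComoving R B m ρ r₀) (hR : 0 < R)
    (hg : ∀ r ∈ Ioc 0 R, 99 / 100 ≤ 4 * π * r ^ 2 * gfun m ρ r) {χ : ℝ} (hχ : χ ∈ Ioc 0 B) :
    χ / 5 ≤ r₀ χ ^ 3 := by
  obtain ⟨hB, h0, -, hc, -, -⟩ := id h
  have hI {s : ℝ} (hs : s ∈ interior (Icc 0 B)) : s ∈ Ioc 0 B := by
    rw [interior_Icc] at hs; exact Ioo_subset_Ioc_self hs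
  have := (convex_Icc 0 B).mul_sub_le_image_sub_of_le_deriv (hc.pow 3) (C := 1 / 5)
    (fun s hs ↦ (h.hasDerivAt_cube (hI hs)).differentiableAt.differentiableWithinAt)
    (fun s hs ↦ (one_fifth_le_cube_deriv hg (h.mem_Ioc hR hg (hI hs))).trans_eq
      (h.hasDerivAt_cube (hI hs)).deriv.symm) 0 (left_mem_Icc.2 hB.le) χ
    (Ioc_subset_Icc_self hχ) hχ.1.le
  simp only [Pi.pow_apply, h0] at this
  linarith

lemma IsComoving.continuousOn_gfun_comp (h : IsComoving R B m ρ r₀) (hR : 0 < R)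
    (hg : ∀ r ∈ Ioc 0 R, 99 / 100 ≤ 4 * π * r ^ 2 * gfun m ρ r)
    (hgc : ContinuousOn (gfun m ρ) (Ioc 0 R)) :
    ContinuousOn (fun χ ↦ gfun m ρ (r₀ χ)) (Ioc 0 B) :=
  hgc.comp (h.2.2.2.1.mono Ioc_subset_Icc_self) fun _ hχ ↦ h.mem_Ioc hR hg hχ

lemma gfun_pos (hg : ∀ r ∈ Ioc 0 R, 99 / 100 ≤ 4 * π * r ^ 2 * gfun m ρ r) {r : ℝ}
    (hr : r ∈ Ioc 0 R) : 0 < gfun m ρ r := by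
  have := hg r hr
  have hr0 := hr.1
  exact pos_of_mul_pos_right (by linarith : 0 < 4 * π * r ^ 2 * gfun m ρ r) (by positivity)

lemma IsComoving.integral_deriv_sq (h : IsComoving R B m ρ r₀) (hR : 0 < R)
    (hg : ∀ r ∈ Ioc 0 R, 99 / 100 ≤ 4 * π * r ^ 2 * gfun m ρ r) {χ : ℝ} (hχ : χ ∈ Ioc 0 B) :
    IntervalIntegrable (fun s ↦ 2 * r₀ s * gfun m ρ (r₀ s)) MeasureTheory.volume 0 χ ∧
      ∫ s in (0:ℝ)..χ, 2 * r₀ s * gfun m ρ (r₀ s) = r₀ χ ^ 2 := by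
  obtain ⟨hB, h0, -, hc, -, hd⟩ := id h
  have hI {s : ℝ} (hs : s ∈ Ioo 0 χ) : s ∈ Ioc 0 B := ⟨hs.1, hs.2.le.trans hχ.2⟩
  have hc' : ContinuousOn (fun s ↦ r₀ s ^ 2) (Icc 0 χ) :=
    (hc.mono (Icc_subset_Icc_right hχ.2)).pow 2
  have hd' : ∀ s ∈ Ioo 0 χ, HasDerivAt (fun s ↦ r₀ s ^ 2) (2 * r₀ s * gfun m ρ (r₀ s)) s :=
    fun s hs ↦ by simpa using (hd s (hI hs)).fun_pow 2
  have hint : IntervalIntegrable (fun s ↦ 2 * r₀ s * gfun m ρ (r₀ s)) MeasureTheory.volume 0 χ := by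
    rw [intervalIntegrable_iff_integrableOn_Ioc_of_le hχ.1.le]
    refine intervalIntegral.integrableOn_deriv_of_nonneg hc' hd' fun s hs ↦ ?_
    have hm := h.mem_Ioc hR hg (hI hs)
    have := gfun_pos hg hm
    have := hm.1
    positivity
  exact ⟨hint, by
    rw [intervalIntegral.integral_eq_sub_of_hasDerivAt_of_le hχ.1.le hc' hd' hint, h0]; ring⟩

lemma exponent_deriv_bounds
    (hg : ∀ r ∈ Ioc 0 R, 99 / 100 ≤ 4 * π * r ^ 2 * gfun m ρ r) {r : ℝ} (hr : r ∈ Ioc 0 R) :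
    0 ≤ 1 / (4 * π * r ^ 3 * gfun m ρ r) ∧
      1 / (4 * π * r ^ 3 * gfun m ρ r) ≤ 8 * (2 * r * gfun m ρ r) := by
  have hr0 := hr.1
  have hg0 := gfun_pos hg hr
  refine ⟨by positivity, ?_⟩
  rw [div_le_iff₀ (by positivity)]
  have h := pow_le_pow_left₀ (by norm_num) (hg r hr) 2
  have hπ := Real.pi_pos
  have hπ' := Real.pi_lt_d2
  have he : 8 * (2 * r * gfun m ρ r) * (4 * π * r ^ 3 * gfun m ρ r) * π =
    4 * (4 * π * r ^ 2 * gfun m ρ r) ^ 2 := by ring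
  by_contra! hlt
  have := mul_lt_mul_of_pos_right hlt hπ
  linarith

lemma IsComoving.intervalIntegrable_exponent (h : IsComoving R B m ρ r₀) (hR : 0 < R)
    (hg : ∀ r ∈ Ioc 0 R, 99 / 100 ≤ 4 * π * r ^ 2 * gfun m ρ r)
    (hgc : ContinuousOn (gfun m ρ) (Ioc 0 R)) {χ : ℝ} (hχ : χ ∈ Ioc 0 B) :
    IntervalIntegrable (fun s ↦ 1 / (4 * π * r₀ s ^ 3 * gfun m ρ (r₀ s))) MeasureTheory.volume 0 χ := by
  have hsub : Ioc 0 χ ⊆ Ioc 0 B := Ioc_subset_Ioc_right hχ.2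
  have hint := ((h.integral_deriv_sq hR hg hχ).1.const_mul 8)
  rw [intervalIntegrable_iff_integrableOn_Ioc_of_le hχ.1.le] at hint ⊢
  refine MeasureTheory.Integrable.mono' hint ?_ ?_
  · have hc : ContinuousOn r₀ (Ioc 0 B) := h.2.2.2.1.mono Ioc_subset_Icc_self
    refine ContinuousOn.aestronglyMeasurable ?_ measurableSet_Ioc
    refine ContinuousOn.mono (continuousOn_const.div ((continuousOn_const.mul (hc.pow 3)).mul
      (h.continuousOn_gfun_comp hR hg hgc)) fun s hs ↦ ?_) hsub
    have hm := h.mem_Ioc hR hg hs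
    have := gfun_pos hg hm
    have := hm.1
    positivity
  · refine (MeasureTheory.ae_restrict_iff' measurableSet_Ioc).2 (.of_forall fun s hs ↦ ?_)
    obtain ⟨h1, h2⟩ := exponent_deriv_bounds hg (h.mem_Ioc hR hg (hsub hs))
    rwa [Real.norm_of_nonneg h1]

lemma IsComoving.exp_bounds (h : IsComoving R B m ρ r₀) (hR : 0 < R) (hR' : R ^ 2 ≤ 1 / 10000)
    (hg : ∀ r ∈ Ioc 0 R, 99 / 100 ≤ 4 * π * r ^ 2 * gfun m ρ r)
    (hgc : ContinuousOn (gfun m ρ) (Ioc 0 R)) {χ : ℝ} (hχ : χ ∈ Ioc 0 B) :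
    1 ≤ Real.exp (∫ s in (0:ℝ)..χ, 1 / (4 * π * r₀ s ^ 3 * gfun m ρ (r₀ s))) ∧
      Real.exp (∫ s in (0:ℝ)..χ, 1 / (4 * π * r₀ s ^ 3 * gfun m ρ (r₀ s))) ≤ 101 / 100 := by
  have hI {s : ℝ} (hs : s ∈ Ioo 0 χ) : r₀ s ∈ Ioc 0 R :=
    h.mem_Ioc hR hg ⟨hs.1, hs.2.le.trans hχ.2⟩
  have hint := h.intervalIntegrable_exponent hR hg hgc hχ
  obtain ⟨hint', heq⟩ := h.integral_deriv_sq hR hg hχ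
  have hlow := intervalIntegral.integral_mono_on_of_le_Ioo hχ.1.le
    (intervalIntegrable_const (c := (0:ℝ))) hint
    fun s hs ↦ (exponent_deriv_bounds hg (hI hs)).1
  have hup := intervalIntegral.integral_mono_on_of_le_Ioo hχ.1.le hint (hint'.const_mul 8)
    fun s hs ↦ (exponent_deriv_bounds hg (hI hs)).2
  rw [intervalIntegral.integral_const_mul, heq] at hup
  rw [intervalIntegral.integral_zero] at hlow
  have hm := h.mem_Ioc hR hg hχ
  have hr : r₀ χ ^ 2 ≤ R ^ 2 := pow_le_pow_left₀ hm.1.le hm.2 2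
  generalize ∫ s in (0:ℝ)..χ, 1 / (4 * π * r₀ s ^ 3 * gfun m ρ (r₀ s)) = J at hlow hup ⊢
  refine ⟨Real.one_le_exp hlow, ?_⟩
  have := (abs_le.1 (Real.abs_exp_sub_one_le (x := J) (by rw [abs_le]; constructor <;> linarith))).2
  rw [abs_of_nonneg hlow] at this
  linarith

lemma IsComoving.continuousOn_energy (h : IsComoving R B m ρ r₀) (hR : 0 < R)
    (hg : ∀ r ∈ Ioc 0 R, 99 / 100 ≤ 4 * π * r ^ 2 * gfun m ρ r) {u v : ℝ → ℝ}
    (hu : C1On u (Icc 0 B)) (hv : ContinuousOn v (Icc 0 B)) :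
    ContinuousOn (fun χ ↦ u χ ^ 2 / r₀ χ ^ 2 + v χ ^ 2 + r₀ χ ^ 4 * deriv u χ ^ 2) (Ioc 0 B) := by
  have hs : Ioc 0 B ⊆ Icc 0 B := Ioc_subset_Icc_self
  have hr := h.2.2.2.1.mono hs
  have hu' : ContinuousOn u (Ioc 0 B) := fun χ hχ ↦
    (hu.1 χ (hs hχ)).continuousAt.continuousWithinAt
  exact (((hu'.pow 2).div (hr.pow 2) fun χ hχ ↦ pow_ne_zero 2 (h.pos hR hg hχ).ne').add
    ((hv.mono hs).pow 2)).add ((hr.pow 4).mul ((hu.2.mono hs).pow 2))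

lemma IsComoving.intervalIntegrable_energy (h : IsComoving R B m ρ r₀) (hR : 0 < R)
    (hg : ∀ r ∈ Ioc 0 R, 99 / 100 ≤ 4 * π * r ^ 2 * gfun m ρ r) {u v : ℝ → ℝ}
    (hu : C1On u (Icc 0 B)) (hu0 : u 0 = 0) (hv : ContinuousOn v (Icc 0 B)) :
    IntervalIntegrable (fun χ ↦ u χ ^ 2 / r₀ χ ^ 2 + v χ ^ 2 + r₀ χ ^ 4 * deriv u χ ^ 2)
      MeasureTheory.volume 0 B := by
  have hB := h.1
  obtain ⟨K, hK⟩ := isCompact_Icc.exists_bound_of_continuousOn hu.2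
  obtain ⟨V, hV⟩ := isCompact_Icc.exists_bound_of_continuousOn hv
  have hK0 : 0 ≤ K := (norm_nonneg _).trans (hK 0 (left_mem_Icc.2 hB.le))
  rw [intervalIntegrable_iff_integrableOn_Ioc_of_le hB.le]
  refine MeasureTheory.IntegrableOn.of_bound measure_Ioc_lt_top ((h.continuousOn_energy hR hg hu hv).aestronglyMeasurable
    measurableSet_Ioc) (25 * K ^ 2 * R ^ 4 + V ^ 2 + R ^ 4 * K ^ 2) ?_
  refine (MeasureTheory.ae_restrict_iff' measurableSet_Ioc).2 (.of_forall fun χ hχ ↦ ?_)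
  have hχ' := Ioc_subset_Icc_self hχ
  have hm := h.mem_Ioc hR hg hχ
  have hr := hm.1
  have hr4 : r₀ χ ^ 4 ≤ R ^ 4 := pow_le_pow_left₀ hr.le hm.2 4
  have hd : deriv u χ ^ 2 ≤ K ^ 2 := by
    rw [← sq_abs]; exact pow_le_pow_left₀ (abs_nonneg _) (hK χ hχ') 2
  have hv2 : v χ ^ 2 ≤ V ^ 2 := by
    rw [← sq_abs]; exact pow_le_pow_left₀ (abs_nonneg _) (hV χ hχ') 2
  have hux : |u χ| ≤ K * (5 * r₀ χ ^ 3) := by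
    have := (convex_Icc 0 B).norm_image_sub_le_of_norm_deriv_le hu.1 hK
      (left_mem_Icc.2 hB.le) hχ'
    rw [hu0, sub_zero, sub_zero, Real.norm_eq_abs, Real.norm_eq_abs, abs_of_pos hχ.1] at this
    exact this.trans (mul_le_mul_of_nonneg_left (by linarith [h.le_cube hR hg hχ]) hK0)
  have hu2 : u χ ^ 2 / r₀ χ ^ 2 ≤ 25 * K ^ 2 * R ^ 4 := by
    have : u χ ^ 2 ≤ (K * (5 * r₀ χ ^ 3)) ^ 2 := by
      rw [← sq_abs]; exact pow_le_pow_left₀ (abs_nonneg _) hux 2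
    calc u χ ^ 2 / r₀ χ ^ 2 ≤ (K * (5 * r₀ χ ^ 3)) ^ 2 / r₀ χ ^ 2 := by gcongr
      _ = 25 * K ^ 2 * r₀ χ ^ 4 := by field_simp; ring
      _ ≤ _ := by gcongr
  rw [Real.norm_of_nonneg (by positivity)]
  gcongr

end Comoving

/-- The second variation of the mass functional of small hard stars is equivalent
to the natural energy. -/
theorem stmt8 :
    ∀ Cs > (0:ℝ), ∃ R₀ > (0:ℝ), ∃ c > (0:ℝ), ∃ C > (0:ℝ),
      ∀ (R B : ℝ) (m ρ r₀ : ℝ → ℝ),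
        IsSmallStar Cs R m ρ → R < R₀ → IsComoving R B m ρ r₀ →
        ∀ u v : ℝ → ℝ, C1On u (Icc 0 B) → u 0 = 0 → ContinuousOn v (Icc 0 B) →
          c * En r₀ B u v ≤ Qform m ρ r₀ B u v ∧
          Qform m ρ r₀ B u v ≤ C * En r₀ B u v := by
  intro Cs hCs
  refine ⟨1 / (100 * (1 + Cs)), by positivity, 1 / 4, by norm_num, 2560, by norm_num, ?_⟩
  intro R B m ρ r₀ hstar hRlt hcom u v hu hu0 hv
  have hR := hstar.1
  have hB := hcom.1
  have hRB := hcom.2.2.1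
  rw [lt_div_iff₀ (by positivity)] at hRlt
  have hCR : 0 < Cs * R := mul_pos hCs hR
  have hR2 : R ^ 2 ≤ 1 / 10000 := by nlinarith
  have hC2 : Cs * R ^ 2 ≤ 1 / 10000 := by nlinarith
  have hg : ∀ r ∈ Ioc 0 R, 99 / 100 ≤ 4 * π * r ^ 2 * gfun m ρ r :=
    fun r hr ↦ (hstar.bounds hR2 hC2 hr).2.2.2.2.2.1
  have hgc := hstar.continuousOn_gfun
  have hpt {χ : ℝ} (hχ : χ ∈ Ioc 0 B) :
      1 / 4 * (u χ ^ 2 / r₀ χ ^ 2 + v χ ^ 2 + r₀ χ ^ 4 * deriv u χ ^ 2) +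
          8 * π * (gfun m ρ (r₀ χ) * u χ ^ 2 + 2 * r₀ χ * u χ * deriv u χ) ≤ Qint m ρ r₀ u v χ ∧
        |Qint m ρ r₀ u v χ| ≤
          2560 * (u χ ^ 2 / r₀ χ ^ 2 + v χ ^ 2 + r₀ χ ^ 4 * deriv u χ ^ 2) ∧
        |gfun m ρ (r₀ χ) * u χ ^ 2 + 2 * r₀ χ * u χ * deriv u χ| ≤
          2560 * (u χ ^ 2 / r₀ χ ^ 2 + v χ ^ 2 + r₀ χ ^ 4 * deriv u χ ^ 2) := by
    have hm := hcom.mem_Ioc hR hg hχ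
    obtain ⟨h1, h2, h3, h4, h5, h6, h7⟩ := hstar.bounds hR2 hC2 hm
    obtain ⟨h8, h9⟩ := hcom.exp_bounds hR hR2 hg hgc hχ
    exact quadratic_form_bounds hm.1 h1 h2 h3 h4 h5 h6 h7 h8 h9 (u χ) (deriv u χ) (v χ)
  have hs : Ioc 0 B ⊆ Icc 0 B := Ioc_subset_Icc_self
  have hmem {χ : ℝ} (hχ : χ ∈ Ioc 0 B) : r₀ χ ∈ Ioc 0 R := hcom.mem_Ioc hR hg hχ
  have hrc := hcom.2.2.2.1
  have hrc' := hrc.mono hs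
  have hucc : ContinuousOn u (Icc 0 B) := fun χ hχ ↦
    (hu.1 χ hχ).continuousAt.continuousWithinAt
  have huc := hucc.mono hs
  have hdc := hu.2.mono hs
  have hvc := hv.mono hs
  have hgc' := hcom.continuousOn_gfun_comp hR hg hgc
  have hmc : ContinuousOn (fun χ ↦ m (r₀ χ)) (Ioc 0 B) :=
    hstar.2.1.comp hrc' fun χ hχ ↦ Ioc_subset_Icc_self (hmem hχ)
  have hρc : ContinuousOn (fun χ ↦ ρ (r₀ χ)) (Ioc 0 B) :=
    hstar.2.2.1.comp hrc' fun χ hχ ↦ Ioc_subset_Icc_self (hmem hχ)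
  have hEc : ContinuousOn
      (fun χ ↦ Real.exp (∫ s in (0:ℝ)..χ, 1 / (4 * π * r₀ s ^ 3 * gfun m ρ (r₀ s))))
      (Ioc 0 B) := by
    have h := intervalIntegral.continuousOn_primitive_interval'
      (hcom.intervalIntegrable_exponent hR hg hgc (right_mem_Ioc.2 hB)) left_mem_uIcc
    rw [uIcc_of_le hB.le] at h
    exact (h.mono hs).rexp
  have hQc : ContinuousOn (Qint m ρ r₀ u v) (Ioc 0 B) := by
    have quot {f : ℝ → ℝ} (hf : ContinuousOn f (Ioc 0 B)) (k j : ℕ) :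
        ContinuousOn (fun χ ↦ f χ / (4 * π * r₀ χ ^ k * gfun m ρ (r₀ χ) ^ j)) (Ioc 0 B) := by
      refine hf.div ((continuousOn_const.mul (hrc'.pow k)).mul (hgc'.pow j)) fun χ hχ ↦ ?_
      have := (hmem hχ).1
      have := gfun_pos hg (hmem hχ)
      positivity
    have quot_one {f : ℝ → ℝ} (hf : ContinuousOn f (Ioc 0 B)) (k : ℕ) :
        ContinuousOn (fun χ ↦ f χ / (4 * π * r₀ χ ^ k * gfun m ρ (r₀ χ))) (Ioc 0 B) := by
      simpa only [pow_one] using quot hf k 1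
    have hforce : ContinuousOn
        (fun χ ↦ 4 * π * r₀ χ * (ρ (r₀ χ) - 1) + m (r₀ χ) / r₀ χ ^ 2) (Ioc 0 B) :=
      ((continuousOn_const.mul hrc').mul (hρc.sub continuousOn_const)).add
        (hmc.div (hrc'.pow 2) fun χ hχ ↦ pow_ne_zero 2 (hmem hχ).1.ne')
    have hlapse : ContinuousOn (fun χ ↦ 1 - 2 * m (r₀ χ) / r₀ χ) (Ioc 0 B) :=
      continuousOn_const.sub
        ((continuousOn_const.mul hmc).div hrc' fun χ hχ ↦ (hmem hχ).1.ne')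
    have hu2 := huc.pow 2
    exact (((((((((continuousOn_const.mul hρc).mul hgc').mul hu2).add
      ((((continuousOn_const.mul hrc').mul hρc).mul huc).mul hdc)).sub
      ((continuousOn_const.mul (quot_one hforce 3)).mul hu2)).add
      ((continuousOn_const.mul (quot_one hlapse 4)).mul hu2)).sub
      (((continuousOn_const.mul (quot hforce 2 2)).mul huc).mul hdc)).add
      ((quot hlapse 2 3).mul (hdc.pow 2))).add
      ((quot_one ((continuousOn_const.mul hρc).sub continuousOn_const) 2).mul (hvc.pow 2))).mul
      hEc
  have hDc : ContinuousOn
      (fun χ ↦ gfun m ρ (r₀ χ) * u χ ^ 2 + 2 * r₀ χ * u χ * deriv u χ) (Ioc 0 B) :=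
    (hgc'.mul (huc.pow 2)).add (((continuousOn_const.mul hrc').mul huc).mul hdc)
  have heint := hcom.intervalIntegrable_energy hR hg hu hu0 hv
  have dominated {f : ℝ → ℝ} (hf : ContinuousOn f (Ioc 0 B))
      (hle : ∀ χ ∈ Ioc 0 B, |f χ| ≤
        2560 * (u χ ^ 2 / r₀ χ ^ 2 + v χ ^ 2 + r₀ χ ^ 4 * deriv u χ ^ 2)) :
      IntervalIntegrable f MeasureTheory.volume 0 B := by
    have h := heint.const_mul 2560
    rw [intervalIntegrable_iff_integrableOn_Ioc_of_le hB.le] at h ⊢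
    exact MeasureTheory.Integrable.mono' h (hf.aestronglyMeasurable measurableSet_Ioc)
      ((MeasureTheory.ae_restrict_iff' measurableSet_Ioc).2 (.of_forall hle))
  have hQint := dominated hQc fun χ hχ ↦ (hpt hχ).2.1
  have hDint := dominated hDc fun χ hχ ↦ (hpt hχ).2.2
  have hD : 0 ≤ ∫ χ in (0:ℝ)..B, (gfun m ρ (r₀ χ) * u χ ^ 2 + 2 * r₀ χ * u χ * deriv u χ) := by
    have h := intervalIntegral.integral_eq_sub_of_hasDerivAt_of_le hB.le
      (f := fun χ ↦ r₀ χ * u χ ^ 2) (hrc.mul (hucc.pow 2)) (fun χ hχ ↦ by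
        have hχ' := Ioo_subset_Ioc_self hχ
        exact ((hcom.2.2.2.2.2 χ hχ').fun_mul
          ((hu.1 χ (hs hχ')).hasDerivAt.fun_pow 2)).congr_deriv (by push_cast; ring)) hDint
    rw [h, hu0, hRB]
    have : 0 ≤ R * u B ^ 2 := by positivity
    linarith
  constructor
  · have h := intervalIntegral.integral_mono_on_of_le_Ioo hB.le
      ((heint.const_mul (1 / 4)).add (hDint.const_mul (8 * π))) hQint
      fun χ hχ ↦ (hpt (Ioo_subset_Ioc_self hχ)).1
    rw [intervalIntegral.integral_add (heint.const_mul _) (hDint.const_mul _),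
      intervalIntegral.integral_const_mul, intervalIntegral.integral_const_mul] at h
    exact (le_add_of_nonneg_right (by positivity)).trans h
  · have h := intervalIntegral.integral_mono_on_of_le_Ioo hB.le hQint (heint.const_mul 2560)
      fun χ hχ ↦ (le_abs_self _).trans (hpt (Ioo_subset_Ioc_self hχ)).2.1
    rwa [intervalIntegral.integral_const_mul] at h

end
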